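/- There is a universal constant C > 0 with the following property. Let t > 0 and let u : ℝ → ℝ be a Schwartz function satisfying ‖u‖_{Ḃ^{-1/2}_{2,∞}} + ‖L(t)u‖_{Ḣ^{1/2}} ≤ 1, where L(t)u(x) := x·u(x) - 3t·u''(x). Then for all x ∈ ℝ one has t^{1/4}⟨x⟩^{1/4}|u(x)| + t^{3/4}⟨x⟩^{-1/4}|u'(x)| ≤ C, and moreover for all x ≥ 2t^{1/3} one has ⟨x⟩|u(x)| + t^{1/2}⟨x⟩^{1/2}|u'(x)| ≤ C·ln(t^{-1/3}⟨x⟩). -/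

import Mathlib

open MeasureTheory Real SchwartzMap Set
open scoped FourierTransform

noncomputable section

/-- Fourier transform of a real-valued function on `ℝ`. -/
def FT (u : ℝ → ℝ) : ℝ → ℂ := 𝓕 (fun x => (u x : ℂ))

/-- Homogeneous Sobolev norm `‖u‖_{Ḣˢ}`. -/
def HsNorm (s : ℝ) (u : ℝ → ℝ) : ℝ :=
  (∫ ξ : ℝ, |ξ| ^ (2 * s) * ‖FT u ξ‖ ^ 2) ^ (1/2 : ℝ)

/-- Homogeneous Besov norm `‖u‖_{Ḃ^{-1/2}_{2,∞}}`. -/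
def BesovNorm (u : ℝ → ℝ) : ℝ :=
  ⨆ j : ℤ, (2:ℝ) ^ (-(j:ℝ)/2) *
    (∫ ξ in {ξ : ℝ | (2:ℝ)^j ≤ |ξ| ∧ |ξ| < (2:ℝ)^(j+1)}, ‖FT u ξ‖^2) ^ (1/2:ℝ)

/-- `L²` norm. -/
def L2Norm (u : ℝ → ℝ) : ℝ := (∫ x : ℝ, u x ^ 2) ^ (1/2:ℝ)

/-- `L²` norm restricted to a set. -/
def L2NormOn (A : Set ℝ) (u : ℝ → ℝ) : ℝ := (∫ x in A, u x ^ 2) ^ (1/2:ℝ)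

/-- The time-dependent japanese bracket `⟨x⟩ = (x² + t^{2/3})^{1/2}`. -/
def jb (t x : ℝ) : ℝ := (x^2 + t ^ ((2:ℝ)/3)) ^ (1/2:ℝ)

/-- Amplitudes `g`, with derivative `g'`, that are bounded by `B` on the positive half-line and
whose derivative has critically weighted `L²` norm at most `B` there. -/
structure CriticalAmplitude (B : ℝ) (g g' : ℝ → ℂ) : Prop where
  hasDerivAt : ∀ k, HasDerivAt g (g' k) k
  continuous_deriv : Continuous g'
  norm_le : ∀ k, 0 < k → ‖g k‖ ≤ B
  energy_le : ∀ p q, 0 < p → p ≤ q → ∫ k in p..q, k * ‖g' k‖ ^ 2 ≤ B ^ 2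

/-- The oscillatory integral with phase `X k + k³` and amplitude `w g`. -/
def cubicIntegral (X : ℝ) (w : ℝ → ℝ) (g : ℝ → ℂ) (p q : ℝ) : ℂ :=
  ∫ k in p..q, Complex.exp (Complex.I * (X * k + k ^ 3 : ℝ)) * (w k * g k)

namespace CriticalAmplitude

variable {B : ℝ} {g g' : ℝ → ℂ}

lemma nonneg (h : CriticalAmplitude B g g') : 0 ≤ B :=
  (norm_nonneg _).trans (h.norm_le 1 one_pos)

lemma continuous (h : CriticalAmplitude B g g') : Continuous g :=
  continuous_iff_continuousAt.2 fun k => (h.hasDerivAt k).continuousAt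

/-- Integration by parts away from the stationary points of the phase `X k + k³`, for an amplitude
`w g` where `g` is bounded by `B` and `√k g'` is bounded by `B` in `L²`. -/
lemma norm_cubicIntegral_le {N X p q σ : ℝ} {w w' F F' : ℝ → ℝ}
    (h : CriticalAmplitude B g g') (hN : 0 < N) (hp : 0 < p) (hpq : p ≤ q)
    (hw : ∀ k, HasDerivAt w (w' k) k) (hw' : Continuous w')
    (hφ : ∀ k ∈ Icc p q, X + 3 * k ^ 2 ≠ 0)
    (hσ : |σ| ≤ 1) (hmono : ∀ k ∈ Icc p q,
      |w' k * (X + 3 * k ^ 2) - w k * (6 * k)| = σ * (w' k * (X + 3 * k ^ 2) - w k * (6 * k)))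
    (hwN : ∀ k ∈ Icc p q, |w k| ≤ N * |X + 3 * k ^ 2|)
    (hF : ∀ k ∈ Icc p q, HasDerivAt F (F' k) k) (hF' : ContinuousOn F' (Icc p q))
    (hwF : ∀ k ∈ Icc p q, w k ^ 2 ≤ F' k * (k * (X + 3 * k ^ 2) ^ 2))
    (hFN : F q - F p ≤ N ^ 2) :
    ‖cubicIntegral X w g p q‖ ≤ (4 * B + B ^ 2 + 1) * N := by
  have hB := h.nonneg
  have hg := h.hasDerivAt
  have hg' := h.continuous_deriv
  have hgB := h.norm_le
  have hgE := h.energy_le p q hp hpq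
  have hgc := h.continuous
  unfold cubicIntegral
  have hu : uIcc p q = Icc p q := uIcc_of_le hpq
  set D : ℝ → ℝ := fun k => X + 3 * k ^ 2 with hD
  set m : ℝ → ℝ := fun k => w k / D k with hm
  set m' : ℝ → ℝ := fun k => (w' k * D k - w k * (6 * k)) / D k ^ 2 with hm'
  set E : ℝ → ℂ := fun k => Complex.exp (Complex.I * (X * k + k ^ 3 : ℝ)) with hE
  have hEn : ∀ k, ‖E k‖ = 1 := fun k => by
    simp only [hE]; rw [mul_comm]; exact Complex.norm_exp_ofReal_mul_I _
  have hEc : Continuous E := by simp only [hE]; fun_prop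
  have hwc : Continuous w := continuous_iff_continuousAt.2 fun k => (hw k).continuousAt
  have hDc : Continuous D := by simp only [hD]; fun_prop
  have hmd : ∀ k ∈ Icc p q, HasDerivAt m (m' k) k := fun k hk => by
    have h1 : HasDerivAt D (6 * k) k := by
      have := ((hasDerivAt_pow 2 k).const_mul 3).const_add X
      convert! this using 1; ring
    exact (hw k).div h1 (hφ k hk)
  have hmc : ContinuousOn m (Icc p q) := fun k hk => (hmd k hk).continuousAt.continuousWithinAt
  have hm'c : ContinuousOn m' (Icc p q) := by
    refine ContinuousOn.div (by fun_prop) (by fun_prop) fun k hk => pow_ne_zero _ (hφ k hk)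
  have hmN : ∀ k ∈ Icc p q, |m k| ≤ N := fun k hk => by
    simp only [hm]; rw [abs_div, div_le_iff₀ (abs_pos.2 (hφ k hk))]; exact hwN k hk
  have hEd : ∀ k, HasDerivAt E (E k * (Complex.I * (D k : ℝ))) k := fun k => by
    have h1 : HasDerivAt (fun k : ℝ => X * k + k ^ 3) (D k) k := by
      have := ((hasDerivAt_id k).const_mul X).add (hasDerivAt_pow 3 k)
      convert! this using 1; simp [hD]
    exact (h1.ofReal_comp.const_mul Complex.I).cexp
  have hP : ∀ k ∈ Icc p q, HasDerivAt (fun k => E k * ((m k : ℂ) * g k))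
      (Complex.I * (E k * (w k * g k)) + E k * ((m' k : ℂ) * g k + m k * g' k)) k := fun k hk => by
    have := (hEd k).mul ((hmd k hk).ofReal_comp.mul (hg k))
    convert! this using 1
    have : (w k : ℂ) = m k * D k := by
      rw [← Complex.ofReal_mul, hm]; simp only; rw [div_mul_cancel₀ _ (hφ k hk)]
    rw [this]; simp only [Pi.mul_apply]; ring
  have hI1 : IntervalIntegrable (fun k => E k * (w k * g k)) volume p q :=
    Continuous.intervalIntegrable (by fun_prop) _ _
  have hI2 : IntervalIntegrable (fun k => E k * ((m' k : ℂ) * g k + m k * g' k)) volume p q := by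
    refine ContinuousOn.intervalIntegrable ?_
    rw [hu]
    have h1 : ContinuousOn (fun k => (m k : ℂ)) (Icc p q) :=
      Complex.continuous_ofReal.comp_continuousOn hmc
    have h2 : ContinuousOn (fun k => (m' k : ℂ)) (Icc p q) :=
      Complex.continuous_ofReal.comp_continuousOn hm'c
    fun_prop
  have key := intervalIntegral.integral_eq_sub_of_hasDerivAt (fun k hk => hP k (hu ▸ hk))
    ((hI1.const_mul Complex.I).add hI2)
  rw [intervalIntegral.integral_add (hI1.const_mul Complex.I) hI2,
    intervalIntegral.integral_const_mul] at key
  have hmi : IntervalIntegrable m' volume p q := ContinuousOn.intervalIntegrable (hu ▸ hm'c)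
  have hFi : IntervalIntegrable F' volume p q := ContinuousOn.intervalIntegrable (hu ▸ hF')
  have hgi : IntervalIntegrable (fun k => k * ‖g' k‖ ^ 2) volume p q :=
    Continuous.intervalIntegrable (by fun_prop) _ _
  have hrem : ‖∫ k in p..q, E k * ((m' k : ℂ) * g k + m k * g' k)‖
      ≤ ∫ k in p..q, (σ * B * m' k + (N / 2 * (k * ‖g' k‖ ^ 2) + 1 / (2 * N) * F' k)) := by
    refine intervalIntegral.norm_integral_le_of_norm_le hpq (Filter.Eventually.of_forall ?_)
      ((hmi.const_mul _).add ((hgi.const_mul _).add (hFi.const_mul _)))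
    intro k hk
    have hk' : k ∈ Icc p q := Ioc_subset_Icc_self hk
    have hk0 : 0 < k := hp.trans hk.1
    have hD0 : 0 < D k ^ 2 := by have := hφ k hk'; positivity
    rw [norm_mul, hEn, one_mul]
    refine (norm_add_le _ _).trans (add_le_add ?_ ?_)
    · rw [norm_mul, Complex.norm_real, Real.norm_eq_abs]
      have : |m' k| = σ * m' k := by
        simp only [hm']; rw [abs_div, abs_of_pos hD0, hmono k hk', mul_div_assoc]
      calc |m' k| * ‖g k‖ ≤ |m' k| * B := by gcongr; exact hgB k hk0
        _ = σ * B * m' k := by rw [this]; ring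
    · rw [norm_mul, Complex.norm_real, Real.norm_eq_abs]
      have hmF : m k ^ 2 ≤ F' k * k := by
        simp only [hm]; rw [div_pow, div_le_iff₀ hD0, mul_assoc]; exact hwF k hk'
      have hF2 : |m k| ^ 2 / k ≤ F' k := by rw [sq_abs, div_le_iff₀ hk0]; exact hmF
      have h1 : 1 / (2 * N) * (|m k| ^ 2 / k) ≤ 1 / (2 * N) * F' k := by gcongr
      refine le_trans ?_ (add_le_add_right h1 _)
      have : N / 2 * (k * ‖g' k‖ ^ 2) + 1 / (2 * N) * (|m k| ^ 2 / k) - |m k| * ‖g' k‖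
          = (N * k * ‖g' k‖ - |m k|) ^ 2 / (2 * N * k) := by field_simp; ring
      have : 0 ≤ (N * k * ‖g' k‖ - |m k|) ^ 2 / (2 * N * k) := by positivity
      linarith
  rw [intervalIntegral.integral_add (hmi.const_mul _) ((hgi.const_mul _).add (hFi.const_mul _)),
    intervalIntegral.integral_add (hgi.const_mul _) (hFi.const_mul _),
    intervalIntegral.integral_const_mul, intervalIntegral.integral_const_mul,
    intervalIntegral.integral_const_mul,
    intervalIntegral.integral_eq_sub_of_hasDerivAt (fun k hk => hmd k (hu ▸ hk)) hmi,
    intervalIntegral.integral_eq_sub_of_hasDerivAt (fun k hk => hF k (hu ▸ hk)) hFi] at hrem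
  have hpm : p ∈ Icc p q := left_mem_Icc.2 hpq
  have hqm : q ∈ Icc p q := right_mem_Icc.2 hpq
  have hbd : ∀ k ∈ Icc p q, ‖E k * ((m k : ℂ) * g k)‖ ≤ N * B := fun k hk => by
    rw [norm_mul, hEn, one_mul, norm_mul, Complex.norm_real, Real.norm_eq_abs]
    exact mul_le_mul (hmN k hk) (hgB k (hp.trans_le hk.1)) (norm_nonneg _) hN.le
  have hV : σ * B * (m q - m p) ≤ 2 * N * B := by
    have h1 : |m q - m p| ≤ 2 * N := (abs_sub _ _).trans (by linarith [hmN p hpm, hmN q hqm])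
    calc σ * B * (m q - m p) ≤ |σ * B * (m q - m p)| := le_abs_self _
      _ = |σ| * |m q - m p| * B := by rw [abs_mul, abs_mul, abs_of_nonneg hB]; ring
      _ ≤ 1 * (2 * N) * B := by gcongr
      _ = _ := by ring
  have h3 : N / 2 * (∫ k in p..q, k * ‖g' k‖ ^ 2) ≤ N / 2 * B ^ 2 := by gcongr
  have h4 : 1 / (2 * N) * (F q - F p) ≤ N / 2 := by
    calc 1 / (2 * N) * (F q - F p) ≤ 1 / (2 * N) * N ^ 2 := by gcongr
      _ = N / 2 := by field_simp
  have h5 : ‖∫ k in p..q, E k * (w k * g k)‖ = ‖Complex.I * ∫ k in p..q, E k * (w k * g k)‖ := by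
    rw [norm_mul, Complex.norm_I, one_mul]
  rw [h5, eq_sub_of_add_eq key]
  refine (norm_sub_le _ _).trans ?_
  have h6 := norm_sub_le (E q * ((m q : ℂ) * g q)) (E p * ((m p : ℂ) * g p))
  have h7 := hbd p hpm
  have h8 := hbd q hqm
  nlinarith [mul_nonneg hN.le (sq_nonneg B)]

lemma norm_cubicIntegral_le_of_weight {X M p q : ℝ} {w : ℝ → ℝ} (h : CriticalAmplitude B g g')
    (hp : 0 ≤ p) (hpq : p ≤ q) (hw : ∀ k ∈ Ioc p q, |w k| ≤ M) :
    ‖cubicIntegral X w g p q‖ ≤ M * B * (q - p) := by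
  have := intervalIntegral.norm_integral_le_of_norm_le_const (a := p) (b := q) (C := M * B)
    (f := fun k => Complex.exp (Complex.I * (X * k + k ^ 3 : ℝ)) * (w k * g k)) ?_
  · rwa [abs_of_nonneg (sub_nonneg.2 hpq)] at this
  · intro k hk
    rw [uIoc_of_le hpq] at hk
    rw [norm_mul, mul_comm Complex.I, Complex.norm_exp_ofReal_mul_I, one_mul, norm_mul,
      Complex.norm_real, Real.norm_eq_abs]
    exact mul_le_mul (hw k hk) (h.norm_le k (hp.trans_lt hk.1)) (norm_nonneg _)
      ((abs_nonneg _).trans (hw k hk))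

lemma norm_cubicIntegral_le_add {X : ℝ} {w : ℝ → ℝ} (h : CriticalAmplitude B g g')
    (hw : Continuous w) (p q r : ℝ) :
    ‖cubicIntegral X w g p r‖ ≤ ‖cubicIntegral X w g p q‖ + ‖cubicIntegral X w g q r‖ := by
  have hg := h.continuous
  have hi : ∀ a b, IntervalIntegrable
      (fun k => Complex.exp (Complex.I * (X * k + k ^ 3 : ℝ)) * (w k * g k)) volume a b :=
    fun a b => Continuous.intervalIntegrable (by fun_prop) _ _
  unfold cubicIntegral
  rw [← intervalIntegral.integral_add_adjacent_intervals (hi p q) (hi q r)]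
  exact norm_add_le _ _

lemma hasDerivAt_div_const_sub (c a k : ℝ) (hk : a - k ≠ 0) :
    HasDerivAt (fun k => c / (a - k)) (c / (a - k) ^ 2) k := by
  have := (hasDerivAt_const k c).div ((hasDerivAt_id k).const_sub a) hk
  convert! this using 1; simp

lemma continuousOn_div_const_sub (c a p q : ℝ) (hk : ∀ k ∈ Icc p q, a - k ≠ 0) :
    ContinuousOn (fun k : ℝ => c / (a - k) ^ 2) (Icc p q) :=
  ContinuousOn.div (by fun_prop) (by fun_prop) fun k hk' => pow_ne_zero _ (hk k hk')

lemma norm_cubicIntegral_one_le_of_bounded {X R : ℝ} (h : CriticalAmplitude B g g')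
    (hX : |X| ≤ 12) (hR : 4 ≤ R) :
    ‖cubicIntegral X (fun _ => 1) g 0 R‖ ≤ 5 * (4 * B + B ^ 2 + 1) := by
  obtain ⟨hX1, hX2⟩ := abs_le.1 hX
  have hB := h.nonneg
  have h0 := h.norm_cubicIntegral_le_add (X := X) (w := fun _ => 1) continuous_const 0 4 R
  have h1 := h.norm_cubicIntegral_le_of_weight (X := X) (w := fun _ => 1) (M := 1) le_rfl
    (show (0 : ℝ) ≤ 4 by norm_num) (by simp)
  have hD : ∀ k ∈ Icc (4 : ℝ) R, 2 * k ^ 2 ≤ X + 3 * k ^ 2 := fun k hk => by nlinarith [hk.1]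
  have h2 := h.norm_cubicIntegral_le (X := X) (w := fun _ => 1) (w' := fun _ => 0) (N := 1)
    (σ := -1) (F := fun k => 1 / (0 - k)) (F' := fun k => 1 / (0 - k) ^ 2) one_pos
    (show (0 : ℝ) < 4 by norm_num) hR
    (fun k => hasDerivAt_const k _) continuous_const
    (fun k hk => by nlinarith [hD k hk, hk.1]) (by simp)
    (fun k hk => by rw [abs_of_nonpos] <;> linarith [hk.1])
    (fun k hk => by rw [abs_one, one_mul]; exact le_trans (by nlinarith [hD k hk, hk.1]) (le_abs_self _))
    (fun k hk => hasDerivAt_div_const_sub _ _ _ (by linarith [hk.1]))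
    (continuousOn_div_const_sub _ _ _ _ fun k hk => by linarith [hk.1])
    (fun k hk => by
      have hk0 : 0 < k := by linarith [hk.1]
      have e : 1 / (0 - k) ^ 2 * (k * (X + 3 * k ^ 2) ^ 2) = (X + 3 * k ^ 2) ^ 2 / k := by
        rw [zero_sub, neg_sq]; field_simp
      rw [e, le_div_iff₀ hk0]
      nlinarith [hD k hk, hk.1, pow_le_pow_left₀ (by positivity) (hD k hk) 2, pow_pos hk0 3,
        mul_pos hk0 hk0])
    (by
      have : 0 < R := by linarith
      have : 0 < 1 / R := by positivity
      simp only [zero_sub, one_div, inv_neg] at *; norm_num; linarith)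
  nlinarith [sq_nonneg B]

lemma norm_cubicIntegral_id_le_of_bounded {X R : ℝ} (h : CriticalAmplitude B g g')
    (hX : |X| ≤ 12) (hR : 4 ≤ R) :
    ‖cubicIntegral X (fun k => k) g 0 R‖ ≤ 5 * (4 * B + B ^ 2 + 1) := by
  obtain ⟨hX1, hX2⟩ := abs_le.1 hX
  have hB := h.nonneg
  have h0 := h.norm_cubicIntegral_le_add (X := X) (w := fun k => k) continuous_id 0 4 R
  have h1 := h.norm_cubicIntegral_le_of_weight (X := X) (w := fun k => k) (M := 4) le_rfl
    (show (0 : ℝ) ≤ 4 by norm_num) (fun k hk => by rw [abs_of_pos hk.1]; exact hk.2)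
  have hD : ∀ k ∈ Icc (4 : ℝ) R, 2 * k ^ 2 ≤ X + 3 * k ^ 2 := fun k hk => by nlinarith [hk.1]
  have h2 := h.norm_cubicIntegral_le (X := X) (w := fun k => k) (w' := fun _ => 1) (N := 1)
    (σ := -1) (F := fun k => 1 / (0 - k)) (F' := fun k => 1 / (0 - k) ^ 2) one_pos
    (show (0 : ℝ) < 4 by norm_num) hR
    (fun k => hasDerivAt_id k) continuous_const
    (fun k hk => by nlinarith [hD k hk, hk.1]) (by simp)
    (fun k hk => by rw [abs_of_nonpos] <;> nlinarith [hk.1])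
    (fun k hk => by
      rw [abs_of_pos (by linarith [hk.1]), one_mul]
      exact le_trans (by nlinarith [hD k hk, hk.1]) (le_abs_self _))
    (fun k hk => hasDerivAt_div_const_sub _ _ _ (by linarith [hk.1]))
    (continuousOn_div_const_sub _ _ _ _ fun k hk => by linarith [hk.1])
    (fun k hk => by
      have hk0 : 0 < k := by linarith [hk.1]
      have e : 1 / (0 - k) ^ 2 * (k * (X + 3 * k ^ 2) ^ 2) = (X + 3 * k ^ 2) ^ 2 / k := by
        rw [zero_sub, neg_sq]; field_simp
      rw [e, le_div_iff₀ hk0]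
      nlinarith [hD k hk, hk.1, pow_le_pow_left₀ (by positivity) (hD k hk) 2, pow_pos hk0 3,
        mul_pos hk0 hk0])
    (by
      have : 0 < R := by linarith
      have : 0 < 1 / R := by positivity
      simp only [zero_sub, one_div, inv_neg] at *; norm_num; linarith)
  nlinarith [sq_nonneg B]

lemma norm_cubicIntegral_one_le_log {X R : ℝ} (h : CriticalAmplitude B g g')
    (hX : 2 ≤ X) (hR : X ≤ R) :
    ‖cubicIntegral X (fun _ => 1) g 0 R‖ ≤ 6 * (4 * B + B ^ 2 + 1) * (log X / X) := by
  have hX0 : 0 < X := by linarith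
  have hB := h.nonneg
  have hX1 : 1 / X ≤ X := by rw [div_le_iff₀ hX0]; nlinarith
  have hL : 1 ≤ 2 * log X := by
    have := Real.log_le_log (by norm_num) hX
    have := Real.log_two_gt_d9
    linarith
  have hc : Continuous (fun _ : ℝ => (1 : ℝ)) := continuous_const
  have h0 := h.norm_cubicIntegral_le_add (X := X) hc 0 (1 / X) R
  have h0' := h.norm_cubicIntegral_le_add (X := X) hc (1 / X) X R
  have h1 := h.norm_cubicIntegral_le_of_weight (X := X) (w := fun _ => 1) (M := 1) le_rfl
    (show 0 ≤ 1 / X by positivity) (by simp)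
  have hN : 0 < 2 * log X / X := by positivity
  have hNX : 1 / X ≤ 2 * log X / X := by gcongr
  have hwN : ∀ k : ℝ, |(1 : ℝ)| ≤ 2 * log X / X * |X + 3 * k ^ 2| := fun k => by
    rw [abs_one, abs_of_pos (by positivity)]
    calc 1 = 1 / X * X := by field_simp
      _ ≤ 2 * log X / X * (X + 3 * k ^ 2) := by gcongr; nlinarith [sq_nonneg k]
  have h2 := h.norm_cubicIntegral_le (X := X) (w := fun _ => 1) (w' := fun _ => 0)
    (N := 2 * log X / X) (p := 1 / X) (q := X)
    (σ := -1) (F := fun k => log k / X ^ 2) (F' := fun k => k⁻¹ / X ^ 2) hN (by positivity) hX1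
    (fun k => hasDerivAt_const k _) continuous_const
    (fun k hk => by positivity) (by simp)
    (fun k hk => by
      have : 0 < k := lt_of_lt_of_le (by positivity) hk.1
      rw [abs_of_nonpos] <;> linarith)
    (fun k hk => hwN k)
    (fun k hk => (Real.hasDerivAt_log (lt_of_lt_of_le (by positivity) hk.1).ne').div_const _)
    ((continuousOn_inv₀.mono fun k hk =>
      (lt_of_lt_of_le (show 0 < 1 / X by positivity) hk.1).ne').div_const _)
    (fun k hk => by
      have hk0 : 0 < k := lt_of_lt_of_le (by positivity) hk.1
      have e : k⁻¹ / X ^ 2 * (k * (X + 3 * k ^ 2) ^ 2) = (X + 3 * k ^ 2) ^ 2 / X ^ 2 := by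
        field_simp
      rw [e, le_div_iff₀ (by positivity), one_pow, one_mul]
      gcongr; nlinarith [sq_nonneg k])
    (by
      rw [one_div, Real.log_inv, div_pow, ← sub_div]
      gcongr; nlinarith)
  have h3 := h.norm_cubicIntegral_le (X := X) (w := fun _ => 1) (w' := fun _ => 0)
    (N := 2 * log X / X) (p := X) (q := R)
    (σ := -1) (F := fun k => 1 / X ^ 2 / (0 - k)) (F' := fun k => 1 / X ^ 2 / (0 - k) ^ 2) hN hX0 hR
    (fun k => hasDerivAt_const k _) continuous_const
    (fun k hk => by positivity) (by simp)
    (fun k hk => by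
      have : 0 < k := hX0.trans_le hk.1
      rw [abs_of_nonpos] <;> linarith)
    (fun k hk => hwN k)
    (fun k hk => hasDerivAt_div_const_sub _ _ _ (by linarith [hk.1]))
    (continuousOn_div_const_sub _ _ _ _ fun k hk => by linarith [hk.1])
    (fun k hk => by
      have hk0 : 0 < k := hX0.trans_le hk.1
      have e : 1 / X ^ 2 / (0 - k) ^ 2 * (k * (X + 3 * k ^ 2) ^ 2)
          = (X + 3 * k ^ 2) ^ 2 / (X ^ 2 * k) := by rw [zero_sub, neg_sq]; field_simp
      rw [e, le_div_iff₀ (by positivity), one_pow, one_mul]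
      have h4 : (k ^ 2) ^ 2 ≤ (X + 3 * k ^ 2) ^ 2 := by gcongr; nlinarith [sq_nonneg k]
      have h5 : X ^ 2 ≤ k ^ 2 := by gcongr; exact hk.1
      have h6 : X ^ 2 * k ≤ k ^ 2 * k := by gcongr
      nlinarith [pow_pos hk0 3, hk.1])
    (by
      have hR0 : 0 < R := hX0.trans_le hR
      have e : 1 / X ^ 2 / (0 - R) - 1 / X ^ 2 / (0 - X) = 1 / X ^ 2 * (1 / X) - 1 / X ^ 2 / R := by
        rw [zero_sub, zero_sub, div_neg, div_neg]; field_simp; ring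
      rw [e]
      have h4 : 1 / X ^ 2 * (1 / X) ≤ 1 / X ^ 2 * 1 := by
        gcongr; rw [div_le_one hX0]; linarith
      have h5 : 0 < 1 / X ^ 2 / R := by positivity
      have h6 : (1 / X) ^ 2 ≤ (2 * log X / X) ^ 2 := by gcongr
      rw [div_pow, one_pow] at h6
      linarith)
  have h4 : 1 * B * (1 / X - 0) ≤ B * (2 * log X / X) := by
    rw [one_mul, sub_zero]; gcongr
  have h5 : 2 * log X / X = 2 * (log X / X) := by ring
  rw [h5] at h2 h3 h4
  have h6 : 0 < log X / X := by linarith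
  nlinarith [sq_nonneg B, mul_nonneg hB h6.le, mul_nonneg (sq_nonneg B) h6.le]

lemma norm_cubicIntegral_id_le_of_pos {c R : ℝ} (h : CriticalAmplitude B g g')
    (hc : 2 / 3 ≤ c ^ 2) (hc0 : 0 < c) (hR : c ≤ R) :
    ‖cubicIntegral (3 * c ^ 2) (fun k => k) g 0 R‖ ≤ 3 * (4 * B + B ^ 2 + 1) * (1 / c) := by
  have hB := h.nonneg
  have hX1 : 1 / (2 * c) ≤ c := by rw [div_le_iff₀ (by positivity)]; nlinarith
  have hp : 0 < 1 / (2 * c) := by positivity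
  have h0 := h.norm_cubicIntegral_le_add (X := 3 * c ^ 2) continuous_id 0 (1 / (2 * c)) R
  have h0' := h.norm_cubicIntegral_le_add (X := 3 * c ^ 2) continuous_id (1 / (2 * c)) c R
  have h1 := h.norm_cubicIntegral_le_of_weight (X := 3 * c ^ 2) (w := fun k => k)
    (M := 1 / (2 * c)) le_rfl hp.le (fun k hk => by rw [abs_of_pos hk.1]; exact hk.2)
  have hN : 0 < 1 / c := by positivity
  have hcont : Continuous fun k : ℝ => k / (9 * (c ^ 2 + k ^ 2) ^ 2) :=
    Continuous.div (by fun_prop) (by fun_prop) fun k => by positivity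
  have hF : ∀ k : ℝ, HasDerivAt (fun k : ℝ => -1 / (18 * (c ^ 2 + k ^ 2)))
      (k / (9 * (c ^ 2 + k ^ 2) ^ 2)) k := fun k => by
    have := (hasDerivAt_const k (-1 : ℝ)).div
      (((hasDerivAt_pow 2 k).const_add (c ^ 2)).const_mul 18) (by positivity)
    convert! this using 1
    field_simp; norm_num; ring
  have hwN : ∀ k : ℝ, 0 < k → |k| ≤ 1 / c * |3 * c ^ 2 + 3 * k ^ 2| := fun k hk => by
    rw [abs_of_pos hk, abs_of_pos (by positivity), one_div_mul_eq_div, le_div_iff₀ hc0]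
    nlinarith [sq_nonneg (c - k), mul_pos hk hc0]
  have hwF : ∀ k : ℝ, 0 < k → k ^ 2 ≤
      k / (9 * (c ^ 2 + k ^ 2) ^ 2) * (k * (3 * c ^ 2 + 3 * k ^ 2) ^ 2) := fun k hk => by
    refine le_of_eq ?_; field_simp; norm_num
  have hFN : ∀ p q : ℝ, -1 / (18 * (c ^ 2 + q ^ 2)) - -1 / (18 * (c ^ 2 + p ^ 2)) ≤ (1 / c) ^ 2 :=
    fun p q => by
      have h1 : 1 / (18 * (c ^ 2 + p ^ 2)) ≤ 1 / c ^ 2 := by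
        gcongr; nlinarith [sq_nonneg p, sq_nonneg c]
      have h2 : 0 < 1 / (18 * (c ^ 2 + q ^ 2)) := by positivity
      rw [div_pow, one_pow, neg_div, neg_div]; linarith
  have h2 := h.norm_cubicIntegral_le (X := 3 * c ^ 2) (σ := 1) hN hp hX1
    (fun k => hasDerivAt_id k) continuous_const
    (fun k hk => by positivity) (by simp)
    (fun k hk => by
      have : 0 < k := hp.trans_le hk.1
      simp only [id]
      rw [abs_of_nonneg] <;> nlinarith [hk.2])
    (fun k hk => hwN k (hp.trans_le hk.1)) (fun k _ => hF k) hcont.continuousOn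
    (fun k hk => hwF k (hp.trans_le hk.1)) (hFN _ _)
  have h3 := h.norm_cubicIntegral_le (X := 3 * c ^ 2) (σ := -1) hN hc0 hR
    (fun k => hasDerivAt_id k) continuous_const
    (fun k hk => by positivity) (by simp)
    (fun k hk => by
      simp only [id]
      rw [abs_of_nonpos] <;> nlinarith [hk.1])
    (fun k hk => hwN k (hc0.trans_le hk.1)) (fun k _ => hF k) hcont.continuousOn
    (fun k hk => hwF k (hc0.trans_le hk.1)) (hFN _ _)
  have h4 : 1 / (2 * c) * B * (1 / (2 * c) - 0) ≤ B * (1 / c) := by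
    have e : 1 / (2 * c) * B * (1 / (2 * c) - 0) = B * (1 / c) * (1 / (4 * c)) := by
      field_simp; ring
    rw [e]
    refine mul_le_of_le_one_right (by positivity) ?_
    rw [div_le_one (by positivity)]; nlinarith
  change ‖cubicIntegral (3 * c ^ 2) id g 0 R‖ ≤ _
  change ‖cubicIntegral (3 * c ^ 2) id g 0 _‖ ≤ _ at h1
  nlinarith [mul_nonneg hB hN.le, mul_nonneg (sq_nonneg B) hN.le]

/-- The contribution of frequencies at distance at least `1 / b` from the stationary point `b²`. -/
lemma norm_cubicIntegral_le_of_separated {b p q : ℝ} (h : CriticalAmplitude B g g') (hb : 0 < b)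
    (hpq : p ≤ q) (hp : 1 / b ≤ p)
    (hsep : q ≤ b ^ 2 - 1 / b ∨ b ^ 2 + 1 / b ≤ p) :
    ‖cubicIntegral (-3 * b ^ 4) (fun _ => 1) g p q‖ ≤ (4 * B + B ^ 2 + 1) * (1 / b) ∧
    (1 ≤ b → ‖cubicIntegral (-3 * b ^ 4) id g p q‖ ≤ (4 * B + B ^ 2 + 1) * b) := by
  have hb1 : 0 < 1 / b := by positivity
  have hp0 : 0 < p := hb1.trans_le hp
  have hk0 : ∀ k ∈ Icc p q, 0 < k := fun k hk => hp0.trans_le hk.1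
  have hs : ∀ k ∈ Icc p q, 1 / b ≤ |b ^ 2 - k| := fun k hk => by
    rw [le_abs]
    rcases hsep with hq | hq
    · left; linarith [hk.2]
    · right; linarith [hk.1]
  have hne : ∀ k ∈ Icc p q, b ^ 2 - k ≠ 0 := fun k hk => abs_pos.1 (hb1.trans_le (hs k hk))
  have hD : ∀ k : ℝ, -3 * b ^ 4 + 3 * k ^ 2 = -3 * (b ^ 2 - k) * (b ^ 2 + k) := fun k => by ring
  have hφ : ∀ k ∈ Icc p q, -3 * b ^ 4 + 3 * k ^ 2 ≠ 0 := fun k hk => by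
    have := hk0 k hk
    rw [hD]; exact mul_ne_zero (mul_ne_zero (by norm_num) (hne k hk)) (by positivity)
  have habs : ∀ k ∈ Icc p q, 3 * (1 / b) * (b ^ 2 + k) ≤ |-3 * b ^ 4 + 3 * k ^ 2| := fun k hk => by
    have := hk0 k hk
    have h1 := hs k hk
    rw [hD, abs_mul, abs_mul, abs_of_pos (show 0 < b ^ 2 + k by positivity),
      show |(-3 : ℝ)| = 3 by norm_num]
    gcongr
  have hF : ∀ c : ℝ, 0 < c → c / (b ^ 2 - q) - c / (b ^ 2 - p) ≤ c * b := fun c hc => by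
    have key : ∀ x, 1 / b ≤ x → 0 < c / x ∧ c / x ≤ c * b := fun x hx => by
      have hx0 : 0 < x := hb1.trans_le hx
      refine ⟨by positivity, ?_⟩
      rw [div_le_iff₀ hx0]
      have : 1 ≤ x * b := by rwa [div_le_iff₀ hb] at hx
      nlinarith
    rcases hsep with hq | hq
    · have h1 := key (b ^ 2 - q) (by linarith)
      have h2 := key (b ^ 2 - p) (by linarith)
      linarith
    · have h1 := key (q - b ^ 2) (by linarith)
      have h2 := key (p - b ^ 2) (by linarith)
      rw [← neg_sub q, ← neg_sub p, div_neg, div_neg]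
      linarith
  constructor
  · refine h.norm_cubicIntegral_le (w := fun _ => 1) (w' := fun _ => 0) (σ := -1)
      (F := fun k => 1 / (9 * b ^ 3) / (b ^ 2 - k))
      (F' := fun k => 1 / (9 * b ^ 3) / (b ^ 2 - k) ^ 2) hb1 hp0 hpq
      (fun k => hasDerivAt_const k _) continuous_const hφ (by simp)
      (fun k hk => ?_) (fun k hk => ?_)
      (fun k hk => hasDerivAt_div_const_sub _ _ _ (hne k hk))
      (continuousOn_div_const_sub _ _ _ _ hne) (fun k hk => ?_) ?_
    · have := hk0 k hk
      rw [abs_of_nonpos] <;> linarith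
    · have := hk0 k hk
      rw [abs_one]
      calc (1 : ℝ) ≤ 1 / b * (3 * (1 / b) * (b ^ 2 + 0)) := by field_simp; nlinarith [pow_pos hb 2]
        _ ≤ 1 / b * (3 * (1 / b) * (b ^ 2 + k)) := by gcongr
        _ ≤ _ := by gcongr; exact habs k hk
    · have := hk0 k hk
      have hn := hne k hk
      have e : 1 / (9 * b ^ 3) / (b ^ 2 - k) ^ 2 * (k * (-3 * b ^ 4 + 3 * k ^ 2) ^ 2)
          = k * (b ^ 2 + k) ^ 2 / b ^ 3 := by rw [hD]; field_simp; norm_num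
      rw [e]
      calc (1 : ℝ) ^ 2 = 1 / b * (b ^ 2 + 0) ^ 2 / b ^ 3 := by field_simp; ring
        _ ≤ _ := by gcongr; exact hp.trans hk.1
    · refine (hF _ (by positivity)).trans ?_
      rw [div_pow, one_pow, one_div_mul_eq_div, div_le_div_iff₀ (by positivity) (by positivity)]
      nlinarith [pow_pos hb 3]
  · intro hb'
    refine h.norm_cubicIntegral_le (w' := fun _ => 1) (σ := -1)
      (F := fun k => 1 / (9 * b ^ 2) / (b ^ 2 - k))
      (F' := fun k => 1 / (9 * b ^ 2) / (b ^ 2 - k) ^ 2) hb hp0 hpq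
      (fun k => hasDerivAt_id k) continuous_const hφ (by simp)
      (fun k hk => ?_) (fun k hk => ?_)
      (fun k hk => hasDerivAt_div_const_sub _ _ _ (hne k hk))
      (continuousOn_div_const_sub _ _ _ _ hne) (fun k hk => ?_) ?_
    · simp only [id]
      have h4 : 0 < b ^ 4 := by positivity
      rw [abs_of_nonpos] <;> nlinarith [sq_nonneg k]
    · have := hk0 k hk
      simp only [id]
      rw [abs_of_pos this]
      calc k ≤ b * (3 * (1 / b) * (b ^ 2 + k)) := by field_simp; nlinarith [sq_nonneg b]
        _ ≤ _ := by gcongr; exact habs k hk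
    · have := hk0 k hk
      have hn := hne k hk
      have e : 1 / (9 * b ^ 2) / (b ^ 2 - k) ^ 2 * (k * (-3 * b ^ 4 + 3 * k ^ 2) ^ 2)
          = k * (b ^ 2 + k) ^ 2 / b ^ 2 := by rw [hD]; field_simp; norm_num
      simp only [id]
      rw [e, le_div_iff₀ (by positivity)]
      nlinarith [mul_pos this (pow_pos hb 4), pow_pos this 3, mul_pos (pow_pos this 2) (pow_pos hb 2)]
    · refine (hF _ (by positivity)).trans ?_
      rw [one_div_mul_eq_div, div_le_iff₀ (by positivity)]
      nlinarith [pow_pos hb 3, pow_le_pow_right₀ hb' (show 1 ≤ 4 by norm_num)]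

lemma norm_cubicIntegral_le_of_neg {b R : ℝ} (h : CriticalAmplitude B g g') (hb : 4 / 3 ≤ b)
    (hR : b ^ 2 + 1 / b ≤ R) :
    ‖cubicIntegral (-3 * b ^ 4) (fun _ => 1) g 0 R‖ ≤ 5 * (4 * B + B ^ 2 + 1) * (1 / b) ∧
    ‖cubicIntegral (-3 * b ^ 4) id g 0 R‖ ≤ 7 * (4 * B + B ^ 2 + 1) * b := by
  have hB := h.nonneg
  have hb0 : 0 < b := by linarith
  have hb1 : 0 < 1 / b := by positivity
  have hb2 : 1 / b ≤ 3 / 4 := by rw [div_le_iff₀ hb0]; linarith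
  have hb3 : 1 / b ≤ b ^ 2 - 1 / b := by nlinarith
  have l := h.norm_cubicIntegral_le_of_separated hb0 hb3 le_rfl (.inl le_rfl)
  have r := h.norm_cubicIntegral_le_of_separated hb0 hR (by nlinarith) (.inr le_rfl)
  have s0 (w : ℝ → ℝ) (hw : Continuous w) : ‖cubicIntegral (-3 * b ^ 4) w g 0 R‖ ≤
      ‖cubicIntegral (-3 * b ^ 4) w g 0 (1 / b)‖
      + ‖cubicIntegral (-3 * b ^ 4) w g (1 / b) (b ^ 2 - 1 / b)‖
      + ‖cubicIntegral (-3 * b ^ 4) w g (b ^ 2 - 1 / b) (b ^ 2 + 1 / b)‖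
      + ‖cubicIntegral (-3 * b ^ 4) w g (b ^ 2 + 1 / b) R‖ := by
    have h1 := h.norm_cubicIntegral_le_add (X := -3 * b ^ 4) hw 0 (1 / b) R
    have h2 := h.norm_cubicIntegral_le_add (X := -3 * b ^ 4) hw (1 / b) (b ^ 2 - 1 / b) R
    have h3 := h.norm_cubicIntegral_le_add (X := -3 * b ^ 4) hw (b ^ 2 - 1 / b) (b ^ 2 + 1 / b) R
    linarith
  constructor
  · have h1 := h.norm_cubicIntegral_le_of_weight (X := -3 * b ^ 4) (w := fun _ => 1) (M := 1) le_rfl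
      hb1.le (by simp)
    have h2 := h.norm_cubicIntegral_le_of_weight (X := -3 * b ^ 4) (w := fun _ => 1) (M := 1)
      (p := b ^ 2 - 1 / b) (q := b ^ 2 + 1 / b) (by linarith) (by linarith) (by simp)
    have := s0 (fun _ => 1) continuous_const
    nlinarith [l.1, r.1, mul_nonneg hB hb1.le, mul_nonneg (sq_nonneg B) hb1.le]
  · have h1 := h.norm_cubicIntegral_le_of_weight (X := -3 * b ^ 4) (w := id) (M := 1) le_rfl
      hb1.le (fun k hk => by rw [id, abs_of_pos hk.1]; linarith [hk.2])
    have h2 := h.norm_cubicIntegral_le_of_weight (X := -3 * b ^ 4) (w := id) (M := 2 * b ^ 2)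
      (p := b ^ 2 - 1 / b) (q := b ^ 2 + 1 / b) (by linarith) (by linarith)
      (fun k hk => by rw [id, abs_of_pos (by linarith [hk.1])]; nlinarith [hk.2])
    have e : 2 * b ^ 2 * B * (b ^ 2 + 1 / b - (b ^ 2 - 1 / b)) = 4 * (B * b) := by field_simp; ring
    have e1 : 1 * B * (1 / b - 0) ≤ B * b := by
      rw [one_mul, sub_zero]; gcongr; linarith
    have := s0 _ continuous_id
    nlinarith [l.2 (by linarith), r.2 (by linarith), mul_nonneg hB hb0.le,
      mul_nonneg (sq_nonneg B) hb0.le]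

/-- Improved decay of the half-line oscillatory integrals when the phase has no stationary point. -/
lemma eventually_norm_cubicIntegral_le_log (h : CriticalAmplitude B g g') {X : ℝ} (hX : 2 ≤ X) :
    ∀ᶠ R in Filter.atTop,
      ‖cubicIntegral X (fun _ => 1) g 0 R‖
        ≤ 12 * (4 * B + B ^ 2 + 1) * (log √(X ^ 2 + 1) * √(X ^ 2 + 1) ^ (-1 : ℝ)) ∧
      ‖cubicIntegral X id g 0 R‖
        ≤ 12 * (4 * B + B ^ 2 + 1) * (log √(X ^ 2 + 1) * √(X ^ 2 + 1) ^ (-(1 : ℝ) / 2)) := by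
  have hX0 : 0 < X := by linarith
  have hB := h.nonneg
  set S := √(X ^ 2 + 1) with hS
  have hXS : X ≤ S := Real.le_sqrt_of_sq_le (by linarith)
  have hSX : S ≤ 4 / 3 * X := Real.sqrt_le_iff.2 ⟨by linarith, by nlinarith⟩
  have hS0 : 0 < S := by linarith
  have hL : log X ≤ log S := Real.log_le_log hX0 hXS
  have hL1 : 1 / 2 ≤ log X := by
    have := Real.log_le_log (by norm_num) hX
    have := Real.log_two_gt_d9
    linarith
  have hK : 0 ≤ 4 * B + B ^ 2 + 1 := by positivity
  filter_upwards [Filter.eventually_ge_atTop X] with R hR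
  constructor
  · refine (h.norm_cubicIntegral_one_le_log hX hR).trans ?_
    rw [Real.rpow_neg_one]
    have : log X / X ≤ 2 * (log S * S⁻¹) := by
      rw [← div_eq_mul_inv, ← mul_div_assoc, div_le_div_iff₀ hX0 hS0]
      nlinarith
    nlinarith
  · set c := √(X / 3) with hc
    have hc0 : 0 < c := Real.sqrt_pos.2 (by positivity)
    have hc2 : c ^ 2 = X / 3 := Real.sq_sqrt (by positivity)
    have hcX : X = 3 * c ^ 2 := by rw [hc2]; ring
    have hcR : c ≤ R := (show c ≤ X by nlinarith).trans hR
    have key := h.norm_cubicIntegral_id_le_of_pos (by rw [hc2]; linarith) hc0 hcR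
    rw [← hcX] at key
    refine key.trans ?_
    have hs : S ^ (-(1 : ℝ) / 2) = 1 / √S := by
      rw [neg_div, Real.rpow_neg hS0.le, ← Real.sqrt_eq_rpow, one_div]
    have hsS : 0 < √S := Real.sqrt_pos.2 hS0
    have hs2 : √S ^ 2 = S := Real.sq_sqrt hS0.le
    have h1 : 1 / c ≤ 4 * (log S * S ^ (-(1 : ℝ) / 2)) := by
      have : √S ≤ 2 * c := by
        refine Real.sqrt_le_iff.2 ⟨by positivity, ?_⟩
        nlinarith
      rw [hs, mul_one_div, ← mul_div_assoc, div_le_div_iff₀ hc0 hsS]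
      have : 1 / 2 * c ≤ log S * c := by gcongr; linarith
      linarith
    nlinarith

/-- Decay of the half-line oscillatory integrals, without restriction on `X`. -/
lemma eventually_norm_cubicIntegral_le (h : CriticalAmplitude B g g') (X : ℝ) :
    ∀ᶠ R in Filter.atTop,
      ‖cubicIntegral X (fun _ => 1) g 0 R‖
        ≤ 20 * (4 * B + B ^ 2 + 1) * √(X ^ 2 + 1) ^ (-(1 : ℝ) / 4) ∧
      ‖cubicIntegral X id g 0 R‖
        ≤ 20 * (4 * B + B ^ 2 + 1) * √(X ^ 2 + 1) ^ ((1 : ℝ) / 4) := by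
  have hB := h.nonneg
  have hK : 0 ≤ 4 * B + B ^ 2 + 1 := by positivity
  set S := √(X ^ 2 + 1) with hS
  have hS1 : 1 ≤ S := Real.one_le_sqrt.2 (by nlinarith [sq_nonneg X])
  have hS0 : 0 < S := by linarith
  have hS2 : S ^ 2 = X ^ 2 + 1 := Real.sq_sqrt (by positivity)
  rcases le_or_gt |X| 12 with hX | hX
  · filter_upwards [Filter.eventually_ge_atTop 4] with R hR
    have h2 : S ^ ((1 : ℝ) / 4) ≤ 2 := by
      have : S ≤ 2 ^ 4 := Real.sqrt_le_iff.2 ⟨by norm_num, by nlinarith [sq_abs X, abs_nonneg X]⟩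
      calc S ^ ((1 : ℝ) / 4) ≤ ((2 : ℝ) ^ 4) ^ ((1 : ℝ) / 4) := by gcongr
        _ = 2 := by rw [← Real.rpow_natCast, ← Real.rpow_mul (by norm_num)]; norm_num
    have h1 : 1 ≤ S ^ ((1 : ℝ) / 4) := Real.one_le_rpow hS1 (by norm_num)
    have h3 : 1 / 2 ≤ S ^ (-(1 : ℝ) / 4) := by
      rw [neg_div, Real.rpow_neg hS0.le, ← one_div]
      exact one_div_le_one_div_of_le (by linarith) h2
    refine ⟨(h.norm_cubicIntegral_one_le_of_bounded hX hR).trans ?_,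
      (h.norm_cubicIntegral_id_le_of_bounded hX hR).trans ?_⟩ <;> nlinarith
  rcases lt_or_ge 0 X with hX0 | hX0
  · rw [abs_of_pos hX0] at hX
    have hlog : log S ≤ 4 / 3 * S ^ ((3 : ℝ) / 4) := by
      have := Real.log_le_rpow_div hS0.le (show (0 : ℝ) < 3 / 4 by norm_num)
      linarith
    filter_upwards [h.eventually_norm_cubicIntegral_le_log (X := X) (by linarith)] with R hR
    rw [← hS] at hR
    refine ⟨hR.1.trans ?_, hR.2.trans ?_⟩
    · have : log S * S ^ (-1 : ℝ) ≤ 4 / 3 * S ^ (-(1 : ℝ) / 4) := by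
        calc log S * S ^ (-1 : ℝ) ≤ 4 / 3 * S ^ ((3 : ℝ) / 4) * S ^ (-1 : ℝ) := by gcongr
          _ = _ := by rw [mul_assoc, ← Real.rpow_add hS0]; norm_num
      nlinarith [Real.rpow_pos_of_pos hS0 (-(1 : ℝ) / 4)]
    · have : log S * S ^ (-(1 : ℝ) / 2) ≤ 4 / 3 * S ^ ((1 : ℝ) / 4) := by
        calc log S * S ^ (-(1 : ℝ) / 2) ≤ 4 / 3 * S ^ ((3 : ℝ) / 4) * S ^ (-(1 : ℝ) / 2) := by
              gcongr
          _ = _ := by rw [mul_assoc, ← Real.rpow_add hS0]; norm_num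
      nlinarith [Real.rpow_pos_of_pos hS0 ((1 : ℝ) / 4)]
  · rw [abs_of_nonpos hX0] at hX
    set b := √√(-X / 3) with hb
    have hb2 : b ^ 2 = √(-X / 3) := Real.sq_sqrt (Real.sqrt_nonneg _)
    have hb4 : b ^ 4 = -X / 3 := by
      rw [show b ^ 4 = (b ^ 2) ^ 2 by ring, hb2, Real.sq_sqrt (by linarith)]
    have hbX : X = -3 * b ^ 4 := by rw [hb4]; ring
    have hb1 : 4 / 3 ≤ b := by
      refine Real.le_sqrt_of_sq_le (Real.le_sqrt_of_sq_le ?_)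
      norm_num; linarith
    have hb0 : 0 < b := by linarith
    have h1 : b ≤ S ^ ((1 : ℝ) / 4) := by
      have : b ^ 4 ≤ S := Real.le_sqrt_of_sq_le (by rw [hb4]; nlinarith)
      calc b = (b ^ 4) ^ ((1 : ℝ) / 4) := by
            rw [← Real.rpow_natCast, ← Real.rpow_mul hb0.le]; norm_num
        _ ≤ _ := by gcongr
    have h2 : S ^ ((1 : ℝ) / 4) ≤ 2 * b := by
      have : S ≤ (2 * b) ^ 4 := by
        rw [mul_pow, hb4]
        exact Real.sqrt_le_iff.2 ⟨by linarith, by nlinarith⟩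
      calc S ^ ((1 : ℝ) / 4) ≤ ((2 * b) ^ 4) ^ ((1 : ℝ) / 4) := by gcongr
        _ = 2 * b := by
          rw [← Real.rpow_natCast, ← Real.rpow_mul (by positivity)]; norm_num
    have h3 : 1 / b ≤ 2 * S ^ (-(1 : ℝ) / 4) := by
      rw [neg_div, Real.rpow_neg hS0.le, ← div_eq_mul_inv,
        div_le_div_iff₀ hb0 (by positivity)]
      linarith
    filter_upwards [Filter.eventually_ge_atTop (b ^ 2 + 1 / b)] with R hR
    have key := h.norm_cubicIntegral_le_of_neg hb1 hR
    rw [← hbX] at key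
    refine ⟨key.1.trans ?_, key.2.trans ?_⟩
    · nlinarith [show 0 < 1 / b by positivity]
    · nlinarith

end CriticalAmplitude

namespace SchwartzMap

/-- The Fourier transform of a real-valued Schwartz function, as a Schwartz function. -/
def ofRealFourier (u : 𝓢(ℝ, ℝ)) : 𝓢(ℝ, ℂ) :=
  𝓕 (SchwartzMap.postcompCLM Complex.ofRealCLM u : 𝓢(ℝ, ℂ))

lemma coe_ofRealFourier (u : 𝓢(ℝ, ℝ)) : ⇑(ofRealFourier u) = FT ⇑u := rfl

/-- The operator `x - 3 t ∂ₓ²` on Schwartz functions. -/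
def airyOp (t : ℝ) (u : 𝓢(ℝ, ℝ)) : 𝓢(ℝ, ℝ) :=
  SchwartzMap.smulLeftCLM ℝ id u - (3 * t) • SchwartzMap.derivCLM ℝ ℝ (SchwartzMap.derivCLM ℝ ℝ u)

lemma coe_derivCLM (u : 𝓢(ℝ, ℝ)) : ⇑(derivCLM ℝ ℝ u) = deriv ⇑u :=
  funext fun x => derivCLM_apply ℝ u x

lemma coe_airyOp (t : ℝ) (u : 𝓢(ℝ, ℝ)) :
    ⇑(airyOp t u) = fun x => x * u x - 3 * t * iteratedDeriv 2 (⇑u) x := by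
  funext x
  have h : Function.HasTemperateGrowth (id : ℝ → ℝ) := by fun_prop
  have h2 : (derivCLM ℝ ℝ (derivCLM ℝ ℝ u)) x = iteratedDeriv 2 (⇑u) x := by
    rw [coe_derivCLM, coe_derivCLM, iteratedDeriv_succ, iteratedDeriv_one]
  rw [← h2]
  simp [airyOp, SchwartzMap.smulLeftCLM_apply_apply h]

lemma integrable_ofReal (u : 𝓢(ℝ, ℝ)) : Integrable (fun x => (u x : ℂ)) :=
  u.integrable.ofReal

lemma FT_derivCLM (u : 𝓢(ℝ, ℝ)) (ξ : ℝ) :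
    FT ⇑(derivCLM ℝ ℝ u) ξ = 2 * π * Complex.I * ξ * FT ⇑u ξ := by
  have hd : deriv (fun x => (u x : ℂ)) = fun x => ((derivCLM ℝ ℝ u x : ℝ) : ℂ) := by
    funext x
    rw [coe_derivCLM]
    exact (u.differentiableAt.hasDerivAt.ofReal_comp).deriv
  have := congrFun (Real.fourier_deriv (f := fun x => (u x : ℂ)) u.integrable_ofReal
    (fun x => u.differentiableAt.hasDerivAt.ofReal_comp.differentiableAt)
    (by rw [hd]; exact (derivCLM ℝ ℝ u).integrable_ofReal)) ξ
  rw [hd] at this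
  exact this

lemma hasDerivAt_FT (u : 𝓢(ℝ, ℝ)) (ξ : ℝ) :
    HasDerivAt (FT ⇑u) (-2 * π * Complex.I * FT (fun x => x * u x) ξ) ξ := by
  have h : Function.HasTemperateGrowth (id : ℝ → ℝ) := by fun_prop
  have hx : (fun x => ((smulLeftCLM ℝ (id : ℝ → ℝ) u x : ℝ) : ℂ)) =
      fun x : ℝ => (x : ℂ) * (u x : ℂ) := by
    funext x
    simp [smulLeftCLM_apply_apply h]
  have h1 := Real.hasDerivAt_fourier (f := fun x => (u x : ℂ)) u.integrable_ofReal
    (by simpa [hx] using (smulLeftCLM ℝ (id : ℝ → ℝ) u).integrable_ofReal) ξ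
  convert! h1 using 1
  unfold FT
  have : (fun x : ℝ => (-2 * ↑π * Complex.I * ↑x) • (u x : ℂ)) =
    (-2 * ↑π * Complex.I : ℂ) • (fun x : ℝ => ((x * u x : ℝ) : ℂ)) := by
    funext x; simp; ring
  rw [this, Real.fourier_eq', Real.fourier_eq', ← integral_const_mul]
  congr 1
  funext x
  simp; ring

lemma FT_airyOp (t : ℝ) (u : 𝓢(ℝ, ℝ)) (ξ : ℝ) :
    FT ⇑(airyOp t u) ξ = FT (fun x => x * u x) ξ + 12 * π ^ 2 * t * ξ ^ 2 * FT ⇑u ξ := by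
  have h : Function.HasTemperateGrowth (id : ℝ → ℝ) := by fun_prop
  have hx : ⇑(smulLeftCLM ℝ (id : ℝ → ℝ) u) = fun x => x * u x := by
    funext x
    simp [smulLeftCLM_apply_apply h]
  have e1 : ofRealFourier (airyOp t u) = ofRealFourier (smulLeftCLM ℝ (id : ℝ → ℝ) u)
      - ((3 * t : ℝ) : ℂ) • ofRealFourier (derivCLM ℝ ℝ (derivCLM ℝ ℝ u)) := by
    have e2 : (postcompCLM Complex.ofRealCLM (airyOp t u) : 𝓢(ℝ, ℂ)) =
        postcompCLM Complex.ofRealCLM (smulLeftCLM ℝ (id : ℝ → ℝ) u) - ((3 * t : ℝ) : ℂ) •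
          postcompCLM Complex.ofRealCLM (derivCLM ℝ ℝ (derivCLM ℝ ℝ u)) := by
      ext x
      simp [airyOp]
    unfold ofRealFourier
    rw [e2, sub_eq_add_neg, FourierTransform.fourier_add, FourierTransform.fourier_neg,
      FourierTransform.fourier_smul, ← sub_eq_add_neg]
  have := congrArg (fun f : 𝓢(ℝ, ℂ) => f ξ) e1
  simp only [sub_apply, smul_apply, coe_ofRealFourier, hx, FT_derivCLM] at this
  rw [this]
  simp only [smul_eq_mul]
  push_cast
  linear_combination (-12 * π ^ 2 * t * ξ ^ 2 * FT ⇑u ξ : ℂ) * Complex.I_sq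

/-- The Fourier transform of `u` with its free Airy oscillation removed. -/
def airyProfile (t : ℝ) (u : 𝓢(ℝ, ℝ)) (ξ : ℝ) : ℂ :=
  Complex.exp (-(Complex.I * (t * (2 * π * ξ) ^ 3 : ℝ))) * FT ⇑u ξ

/-- The derivative of `airyProfile`. -/
def airyProfileDeriv (t : ℝ) (u : 𝓢(ℝ, ℝ)) (ξ : ℝ) : ℂ :=
  -(2 * π * Complex.I) *
    (Complex.exp (-(Complex.I * (t * (2 * π * ξ) ^ 3 : ℝ))) * FT ⇑(airyOp t u) ξ)

lemma norm_exp_neg_I_mul (a : ℝ) : ‖Complex.exp (-(Complex.I * a))‖ = 1 := by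
  rw [show -(Complex.I * (a : ℂ)) = ((-a : ℝ) : ℂ) * Complex.I by push_cast; ring]
  exact Complex.norm_exp_ofReal_mul_I _

lemma norm_airyProfile (t : ℝ) (u : 𝓢(ℝ, ℝ)) (ξ : ℝ) : ‖airyProfile t u ξ‖ = ‖FT ⇑u ξ‖ := by
  rw [airyProfile, norm_mul, norm_exp_neg_I_mul, one_mul]

lemma norm_airyProfileDeriv (t : ℝ) (u : 𝓢(ℝ, ℝ)) (ξ : ℝ) :
    ‖airyProfileDeriv t u ξ‖ = 2 * π * ‖FT ⇑(airyOp t u) ξ‖ := by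
  rw [airyProfileDeriv, norm_mul, norm_mul, norm_exp_neg_I_mul, one_mul, norm_neg]
  simp [abs_of_pos pi_pos]

lemma continuous_FT (u : 𝓢(ℝ, ℝ)) : Continuous (FT ⇑u) := (ofRealFourier u).continuous

lemma continuous_airyProfileDeriv (t : ℝ) (u : 𝓢(ℝ, ℝ)) : Continuous (airyProfileDeriv t u) := by
  have := (airyOp t u).continuous_FT
  unfold airyProfileDeriv
  fun_prop

lemma hasDerivAt_airyProfile (t : ℝ) (u : 𝓢(ℝ, ℝ)) (ξ : ℝ) :
    HasDerivAt (airyProfile t u) (airyProfileDeriv t u ξ) ξ := by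
  have h1 : HasDerivAt (fun ξ : ℝ => t * (2 * π * ξ) ^ 3) (24 * π ^ 3 * t * ξ ^ 2) ξ := by
    have := (((hasDerivAt_id ξ).const_mul (2 * π)).pow 3).const_mul t
    convert! this using 1
    simp; ring
  have h2 := ((h1.ofReal_comp.const_mul Complex.I).neg.cexp).mul (u.hasDerivAt_FT ξ)
  convert! h2 using 1
  rw [airyProfileDeriv, FT_airyOp]
  simp only [Pi.neg_apply]
  push_cast
  ring

end SchwartzMap

namespace SchwartzMap

lemma exists_norm_FT_le (u : 𝓢(ℝ, ℝ)) : ∃ C, 0 < C ∧ ∀ ξ, ‖FT ⇑u ξ‖ ≤ C := by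
  obtain ⟨C, hC, h⟩ := (ofRealFourier u).decay 0 0
  exact ⟨C, hC, fun ξ => by simpa [coe_ofRealFourier] using h ξ⟩

lemma BesovNorm_nonneg (u : ℝ → ℝ) : 0 ≤ BesovNorm u :=
  Real.iSup_nonneg fun _ => mul_nonneg (rpow_nonneg two_pos.le _)
    (rpow_nonneg (integral_nonneg fun _ => sq_nonneg _) _)

lemma HsNorm_nonneg (s : ℝ) (u : ℝ → ℝ) : 0 ≤ HsNorm s u :=
  rpow_nonneg (integral_nonneg fun _ =>
    mul_nonneg (rpow_nonneg (abs_nonneg _) _) (sq_nonneg _)) _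

/-- The supremum defining the Besov norm of a Schwartz function is finite. -/
lemma bddAbove_BesovNorm (u : 𝓢(ℝ, ℝ)) : BddAbove (Set.range fun j : ℤ =>
    (2:ℝ) ^ (-(j:ℝ)/2) *
      (∫ ξ in {ξ : ℝ | (2:ℝ)^j ≤ |ξ| ∧ |ξ| < (2:ℝ)^(j+1)}, ‖FT ⇑u ξ‖^2) ^ (1/2:ℝ)) := by
  obtain ⟨C, hC, h⟩ := u.exists_norm_FT_le
  refine ⟨2 * C, ?_⟩
  rintro _ ⟨j, rfl⟩
  have h2 : (0:ℝ) < 2 ^ j := by positivity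
  have hsub : {ξ : ℝ | (2:ℝ)^j ≤ |ξ| ∧ |ξ| < (2:ℝ)^(j+1)} ⊆ Icc (-(2:ℝ)^(j+1)) ((2:ℝ)^(j+1)) :=
    fun ξ hξ => abs_le.1 hξ.2.le
  have hint : ∫ ξ in {ξ : ℝ | (2:ℝ)^j ≤ |ξ| ∧ |ξ| < (2:ℝ)^(j+1)}, ‖FT ⇑u ξ‖^2 ≤
      (2 * C) ^ 2 * 2 ^ j := by
    have hc : Continuous fun ξ => ‖FT ⇑u ξ‖ ^ 2 := by
      have := u.continuous_FT
      fun_prop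
    calc _ ≤ ∫ ξ in Icc (-(2:ℝ)^(j+1)) ((2:ℝ)^(j+1)), ‖FT ⇑u ξ‖^2 :=
          setIntegral_mono_set hc.continuousOn.integrableOn_Icc
            (Filter.Eventually.of_forall fun _ => sq_nonneg _) hsub.eventuallyLE
      _ ≤ ∫ ξ in Icc (-(2:ℝ)^(j+1)) ((2:ℝ)^(j+1)), C ^ 2 := by
          refine setIntegral_mono hc.continuousOn.integrableOn_Icc
            continuous_const.continuousOn.integrableOn_Icc fun ξ => ?_
          exact pow_le_pow_left₀ (norm_nonneg _) (h ξ) 2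
      _ = (2 * C) ^ 2 * 2 ^ j := by
          rw [setIntegral_const, smul_eq_mul,
            Real.volume_real_Icc_of_le (by linarith [show (0:ℝ) < 2 ^ (j+1) by positivity]),
            zpow_add_one₀ two_ne_zero]
          ring
  calc _ ≤ (2:ℝ) ^ (-(j:ℝ)/2) * ((2 * C) ^ 2 * 2 ^ j) ^ (1/2:ℝ) :=
        mul_le_mul_of_nonneg_left (rpow_le_rpow (integral_nonneg fun _ => sq_nonneg _) hint
          (by norm_num)) (by positivity)
    _ = 2 * C := by
      rw [mul_rpow (by positivity) (by positivity), ← sqrt_eq_rpow ((2 * C) ^ 2),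
        sqrt_sq (by positivity), ← rpow_intCast, ← rpow_mul two_pos.le, mul_left_comm,
        ← rpow_add two_pos]
      ring_nf
      simp

lemma setIntegral_norm_FT_sq_le {u : 𝓢(ℝ, ℝ)} (hu : BesovNorm ⇑u ≤ 1) (j : ℤ) :
    ∫ ξ in {ξ : ℝ | (2:ℝ)^j ≤ |ξ| ∧ |ξ| < (2:ℝ)^(j+1)}, ‖FT ⇑u ξ‖^2 ≤ 2 ^ j := by
  have h := (le_ciSup u.bddAbove_BesovNorm j).trans hu
  set A := ∫ ξ in {ξ : ℝ | (2:ℝ)^j ≤ |ξ| ∧ |ξ| < (2:ℝ)^(j+1)}, ‖FT ⇑u ξ‖^2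
  have hA : 0 ≤ A := integral_nonneg fun _ => sq_nonneg _
  have h2 := pow_le_pow_left₀ (by positivity) h 2
  simp only [mul_pow, one_pow] at h2
  rw [← sqrt_eq_rpow, sq_sqrt hA, ← rpow_natCast, ← rpow_mul two_pos.le,
    show -(j:ℝ) / 2 * (2:ℕ) = -(j:ℝ) by push_cast; ring, rpow_neg two_pos.le, rpow_intCast,
    inv_mul_le_iff₀ (by positivity), mul_one] at h2
  exact h2

/-- Besov control gives a point of every dyadic interval where the Fourier transform is small. -/
lemma exists_norm_FT_le_one {u : 𝓢(ℝ, ℝ)} (hu : BesovNorm ⇑u ≤ 1) (j : ℤ) :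
    ∃ ξ ∈ Icc ((2:ℝ) ^ j) (2 ^ (j + 1)), ‖FT ⇑u ξ‖ ≤ 1 := by
  by_contra! hcon
  have h2 : (0:ℝ) < 2 ^ j := by positivity
  have h3 : (2:ℝ) ^ (j + 1) = 2 * 2 ^ j := by rw [zpow_add_one₀ two_ne_zero]; ring
  have hlt : (2:ℝ) ^ j < 2 ^ (j + 1) := by linarith
  have hc : Continuous fun ξ => ‖FT ⇑u ξ‖ ^ 2 := by
    have := u.continuous_FT
    fun_prop
  have hle : ∫ ξ in (2:ℝ) ^ j..2 ^ (j + 1), ‖FT ⇑u ξ‖ ^ 2 ≤ 2 ^ j := by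
    refine le_trans ?_ (setIntegral_norm_FT_sq_le hu j)
    rw [intervalIntegral.integral_of_le hlt.le, integral_Ioc_eq_integral_Ioo]
    refine setIntegral_mono_set ?_ (Filter.Eventually.of_forall fun _ => sq_nonneg _)
      (LE.le.eventuallyLE fun ξ hξ => ?_)
    · refine (hc.continuousOn.integrableOn_Icc (a := -(2:ℝ)^(j+1)) (b := 2 ^ (j+1))).mono_set
        fun ξ hξ => abs_le.1 hξ.2.le
    · have : |ξ| = ξ := abs_of_pos (h2.trans hξ.1)
      exact ⟨this.symm ▸ hξ.1.le, this.symm ▸ hξ.2⟩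
  have hpos : 0 < ∫ ξ in (2:ℝ) ^ j..2 ^ (j + 1), (‖FT ⇑u ξ‖ ^ 2 - 1) := by
    refine intervalIntegral.intervalIntegral_pos_of_pos_on
      ((hc.sub continuous_const).intervalIntegrable _ _) (fun ξ hξ => ?_) hlt
    have := hcon ξ (Ioo_subset_Icc_self hξ)
    nlinarith
  rw [intervalIntegral.integral_sub (hc.intervalIntegrable _ _)
    (continuous_const.intervalIntegrable _ _), intervalIntegral.integral_const] at hpos
  simp at hpos
  linarith

lemma integral_mul_norm_FT_sq_le {v : 𝓢(ℝ, ℝ)} (hv : HsNorm (1/2) ⇑v ≤ 1) {p q : ℝ}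
    (hp : 0 < p) (hpq : p ≤ q) : ∫ ξ in p..q, ξ * ‖FT ⇑v ξ‖ ^ 2 ≤ 1 := by
  have hI : ∫ ξ : ℝ, |ξ| * ‖FT ⇑v ξ‖ ^ 2 ≤ 1 := by
    have h0 : 0 ≤ ∫ ξ : ℝ, |ξ| * ‖FT ⇑v ξ‖ ^ 2 := integral_nonneg fun _ => by positivity
    have h1 : HsNorm (1/2) ⇑v = √(∫ ξ : ℝ, |ξ| * ‖FT ⇑v ξ‖ ^ 2) := by
      rw [HsNorm, sqrt_eq_rpow]; norm_num
    rw [h1, sqrt_le_iff] at hv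
    simpa using hv.2
  refine le_trans ?_ hI
  have hint : Integrable fun ξ : ℝ => |ξ| * ‖FT ⇑v ξ‖ ^ 2 := by
    obtain ⟨C, hC, h⟩ := v.exists_norm_FT_le
    have hc := v.continuous_FT
    refine Integrable.mono' (((ofRealFourier v).integrable_pow_mul volume 1).const_mul C)
      (Continuous.aestronglyMeasurable (by fun_prop)) (Filter.Eventually.of_forall fun ξ => ?_)
    rw [coe_ofRealFourier, norm_of_nonneg (by positivity), pow_one, norm_eq_abs]
    have := mul_le_mul_of_nonneg_left (h ξ) (mul_nonneg (abs_nonneg ξ) (norm_nonneg (FT ⇑v ξ)))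
    nlinarith
  rw [intervalIntegral.integral_of_le hpq]
  calc _ = ∫ ξ in Ioc p q, |ξ| * ‖FT ⇑v ξ‖ ^ 2 :=
        setIntegral_congr_fun measurableSet_Ioc fun ξ hξ => by
          simp only [abs_of_pos (hp.trans hξ.1)]
    _ ≤ _ := setIntegral_le_integral hint (Filter.Eventually.of_forall fun ξ => by
        simp only [Pi.zero_apply]; positivity)

/-- Control of `u` in `Ḃ^{-1/2}_{2,∞}` and of `(x - 3 t ∂ₓ²) u` in `Ḣ^{1/2}` makes the Airy profile
a critical amplitude. -/
lemma criticalAmplitude_airyProfile {t : ℝ} {u : 𝓢(ℝ, ℝ)} (hu : BesovNorm ⇑u ≤ 1)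
    (hv : HsNorm (1/2) ⇑(airyOp t u) ≤ 1) :
    CriticalAmplitude 8 (airyProfile t u) (airyProfileDeriv t u) := by
  have hc := (airyOp t u).continuous_FT
  have hπ := pi_lt_d2
  have hπ0 := pi_pos
  refine ⟨u.hasDerivAt_airyProfile t, u.continuous_airyProfileDeriv t, fun ξ hξ => ?_,
    fun p q hp hpq => ?_⟩
  · obtain ⟨j, hj⟩ := exists_mem_Ico_zpow hξ one_lt_two
    have hj' : ξ ∈ Icc ((2:ℝ) ^ j) (2 ^ (j + 1)) := Ico_subset_Icc_self hj
    have h2 : (0:ℝ) < 2 ^ j := by positivity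
    have h3 : (2:ℝ) ^ (j + 1) = 2 * 2 ^ j := by rw [zpow_add_one₀ two_ne_zero]; ring
    have hosc : ∀ a ∈ Icc ((2:ℝ) ^ j) (2 ^ (j + 1)), ∀ b ∈ Icc ((2:ℝ) ^ j) (2 ^ (j + 1)),
        a ≤ b → ‖airyProfile t u b - airyProfile t u a‖ ≤ 2 * π := by
      intro a ha b hb hab
      have ha0 : 0 < a := h2.trans_le ha.1
      have hne : ∀ k ∈ uIcc a b, k ≠ 0 := fun k hk => by
        rw [uIcc_of_le hab] at hk; exact (ha0.trans_le hk.1).ne'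
      have hi1 : IntervalIntegrable (fun k => k * ‖FT ⇑(airyOp t u) k‖ ^ 2) volume a b :=
        Continuous.intervalIntegrable (by fun_prop) _ _
      have hi2 : IntervalIntegrable (fun k : ℝ => k⁻¹) volume a b :=
        (continuousOn_id.inv₀ hne).intervalIntegrable
      rw [← intervalIntegral.integral_eq_sub_of_hasDerivAt
        (fun k _ => u.hasDerivAt_airyProfile t k)
        ((u.continuous_airyProfileDeriv t).intervalIntegrable _ _)]
      calc _ ≤ ∫ k in a..b, π * (k * ‖FT ⇑(airyOp t u) k‖ ^ 2 + k⁻¹) := by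
            refine intervalIntegral.norm_integral_le_of_norm_le hab
              (Filter.Eventually.of_forall fun k hk => ?_) ((hi1.add hi2).const_mul _)
            have hk0 : 0 < k := ha0.trans hk.1
            rw [norm_airyProfileDeriv, mul_comm 2 π, mul_assoc]
            refine mul_le_mul_of_nonneg_left ?_ hπ0.le
            set n := ‖FT ⇑(airyOp t u) k‖
            have : k * n ^ 2 + k⁻¹ - 2 * n = k⁻¹ * (k * n - 1) ^ 2 := by field_simp; ring
            nlinarith [mul_nonneg (inv_pos.2 hk0).le (sq_nonneg (k * n - 1))]
        _ = π * ((∫ k in a..b, k * ‖FT ⇑(airyOp t u) k‖ ^ 2) + log (b / a)) := by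
            rw [intervalIntegral.integral_const_mul, intervalIntegral.integral_add hi1 hi2,
              integral_inv_of_pos ha0 (ha0.trans_le hab)]
        _ ≤ π * (1 + 1) := by
            have hba : b / a ≤ 2 := by
              rw [div_le_iff₀ ha0]; linarith [ha.1, hb.2]
            have := log_le_sub_one_of_pos (div_pos (ha0.trans_le hab) ha0)
            gcongr
            · exact integral_mul_norm_FT_sq_le hv ha0 hab
            · linarith
        _ = 2 * π := by ring
    obtain ⟨ξ₀, hξ₀, h1⟩ := exists_norm_FT_le_one hu j
    rw [← norm_airyProfile t] at h1
    have hd : ‖airyProfile t u ξ - airyProfile t u ξ₀‖ ≤ 2 * π := by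
      rcases le_total ξ₀ ξ with h | h
      · exact hosc _ hξ₀ _ hj' h
      · rw [norm_sub_rev]; exact hosc _ hj' _ hξ₀ h
    have := norm_le_norm_add_norm_sub' (airyProfile t u ξ) (airyProfile t u ξ₀)
    linarith
  · have : ∀ k : ℝ, k * ‖airyProfileDeriv t u k‖ ^ 2 =
        (2 * π) ^ 2 * (k * ‖FT ⇑(airyOp t u) k‖ ^ 2) := fun k => by
      rw [norm_airyProfileDeriv]; ring
    simp only [this, intervalIntegral.integral_const_mul]
    nlinarith [integral_mul_norm_FT_sq_le hv hp hpq]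

end SchwartzMap

lemma CriticalAmplitude.comp_mul_left {B c : ℝ} {g g' : ℝ → ℂ} (h : CriticalAmplitude B g g')
    (hc : 0 < c) : CriticalAmplitude B (fun k => g (c * k)) (fun k => c * g' (c * k)) := by
  have hcont := h.continuous_deriv
  refine ⟨fun k => ?_, by fun_prop, fun k hk => h.norm_le _ (by positivity), fun p q hp hpq => ?_⟩
  · have := (h.hasDerivAt (c * k)).scomp k ((hasDerivAt_id k).const_mul c)
    simpa [Function.comp_def] using this
  · have e : ∀ k : ℝ, k * ‖c * g' (c * k)‖ ^ 2 = c * ((c * k) * ‖g' (c * k)‖ ^ 2) := fun k => by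
      rw [norm_mul, Complex.norm_real, norm_of_nonneg hc.le]; ring
    simp only [e, intervalIntegral.integral_const_mul]
    rw [intervalIntegral.integral_comp_mul_left (fun k => k * ‖g' k‖ ^ 2) hc.ne', smul_eq_mul,
      mul_inv_cancel_left₀ hc.ne']
    exact h.energy_le _ _ (by positivity) (by gcongr)

namespace SchwartzMap

lemma FT_neg (f : ℝ → ℝ) (ξ : ℝ) : FT f (-ξ) = (starRingEnd ℂ) (FT f ξ) := by
  unfold FT
  rw [Real.fourier_eq', Real.fourier_eq', ← integral_conj]
  congr 1
  funext x
  simp [← Complex.exp_conj, Complex.conj_ofNat]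

/-- Pointwise bound by Fourier inversion on the positive half-line. -/
lemma abs_le_two_mul_of_tendsto {f : 𝓢(ℝ, ℝ)} {x l M : ℝ} {c : ℂ} {w : ℝ → ℝ} {g : ℝ → ℂ}
    (hl : 0 < l)
    (hf : ∀ k : ℝ, FT ⇑f (l * k) = c * (Complex.exp (Complex.I * (k ^ 3 : ℝ)) * (w k * g k)))
    (hM : ∀ᶠ R in Filter.atTop, ‖cubicIntegral (2 * π * l * x) w g 0 R‖ ≤ M) :
    |f x| ≤ 2 * l * ‖c‖ * M := by
  set h : ℝ → ℂ := fun ξ => Complex.exp ((2 * π * ξ * x : ℝ) * Complex.I) * FT ⇑f ξ with hh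
  have hinv : (f x : ℂ) = ∫ ξ, h ξ := by
    have h1 : 𝓕⁻ (ofRealFourier f) = postcompCLM Complex.ofRealCLM f :=
      FourierTransform.fourierInv_fourier_eq _
    have h2 := congrArg (fun F : 𝓢(ℝ, ℂ) => F x) h1
    simp only [fourierInv_coe, Real.fourierInv_eq', coe_ofRealFourier] at h2
    rw [show (f x : ℂ) = (postcompCLM Complex.ofRealCLM f : 𝓢(ℝ, ℂ)) x by simp, ← h2]
    congr 1
    funext ξ
    simp [hh, mul_assoc, mul_comm x]
  have hnorm : ∀ ξ, ‖h ξ‖ = ‖FT ⇑f ξ‖ := fun ξ => by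
    rw [hh, norm_mul, Complex.norm_exp_ofReal_mul_I, one_mul]
  have hint : Integrable h := by
    have hc := f.continuous_FT
    exact (ofRealFourier f).integrable.norm.mono' (by fun_prop)
      (Filter.Eventually.of_forall fun ξ => (hnorm ξ).le)
  have hneg : ∀ ξ, h (-ξ) = (starRingEnd ℂ) (h ξ) := fun ξ => by
    simp only [hh, FT_neg, map_mul, ← Complex.exp_conj]
    simp [Complex.conj_ofNat]
  have hIic : ‖∫ ξ in Iic 0, h ξ‖ = ‖∫ ξ in Ioi 0, h ξ‖ := by
    have := integral_comp_neg_Ioi 0 h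
    rw [neg_zero] at this
    simp only [← this, hneg]
    rw [integral_conj, RCLike.norm_conj]
  have hpos : ‖∫ ξ in Ioi 0, h ξ‖ ≤ l * ‖c‖ * M := by
    have hscale : ∫ ξ in Ioi 0, h ξ = l * ∫ k in Ioi 0, h (l * k) := by
      rw [integral_comp_mul_left_Ioi h 0 hl, mul_zero, Complex.real_smul]
      have : (l : ℂ) ≠ 0 := by exact_mod_cast hl.ne'
      push_cast
      field_simp
    have hlim := intervalIntegral_tendsto_integral_Ioi 0
      (hint.comp_mul_left' hl.ne').integrableOn Filter.tendsto_id
    have hle : ‖∫ k in Ioi 0, h (l * k)‖ ≤ ‖c‖ * M := by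
      refine le_of_tendsto hlim.norm (hM.mono fun R hR => ?_)
      have e : ∫ k in 0..id R, h (l * k) = c * cubicIntegral (2 * π * l * x) w g 0 R := by
        rw [cubicIntegral, ← intervalIntegral.integral_const_mul]
        refine intervalIntegral.integral_congr fun k _ => ?_
        simp only [hh, hf]
        rw [show Complex.I * (2 * π * l * x * k + k ^ 3 : ℝ) =
          (2 * π * (l * k) * x : ℝ) * Complex.I + Complex.I * (k ^ 3 : ℝ) by push_cast; ring,
          Complex.exp_add]
        ring
      rw [e, norm_mul]
      gcongr
    rw [hscale, norm_mul, Complex.norm_real, norm_of_nonneg hl.le, mul_assoc]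
    gcongr
  have : |f x| ≤ ‖∫ ξ in Iic 0, h ξ‖ + ‖∫ ξ in Ioi 0, h ξ‖ := by
    rw [← norm_eq_abs, ← Complex.norm_real, hinv,
      ← intervalIntegral.integral_Iic_add_Ioi (hint.integrableOn (s := Iic 0))
        hint.integrableOn]
    exact norm_add_le _ _
  rw [hIic] at this
  linarith

/-- Pointwise bounds for `u` and `u'` in terms of Airy-type integrals of the rescaled profile. -/
lemma abs_apply_and_abs_deriv_le {r : ℝ} (hr : 0 < r) (u : 𝓢(ℝ, ℝ)) (x : ℝ) {M₀ M₁ : ℝ}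
    (hM : ∀ᶠ R in Filter.atTop,
      ‖cubicIntegral (x / r) (fun _ => 1)
        (fun k => airyProfile (r ^ 3) u ((2 * π * r)⁻¹ * k)) 0 R‖ ≤ M₀ ∧
      ‖cubicIntegral (x / r) id
        (fun k => airyProfile (r ^ 3) u ((2 * π * r)⁻¹ * k)) 0 R‖ ≤ M₁) :
    r * |u x| ≤ M₀ ∧ r ^ 2 * |deriv ⇑u x| ≤ M₁ := by
  have hπ := pi_pos
  have hπ3 := pi_gt_three
  set l := (2 * π * r)⁻¹ with hl
  have hl0 : 0 < l := by positivity
  have hlr : 2 * π * l * r = 1 := by rw [hl]; field_simp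
  have hX : 2 * π * l * x = x / r := by rw [hl]; field_simp
  have hprof : ∀ k : ℝ, FT ⇑u (l * k) =
      Complex.exp (Complex.I * (k ^ 3 : ℝ)) * airyProfile (r ^ 3) u (l * k) := fun k => by
    have : r ^ 3 * (2 * π * (l * k)) ^ 3 = k ^ 3 := by
      calc _ = (2 * π * l * r) ^ 3 * k ^ 3 := by ring
        _ = k ^ 3 := by rw [hlr]; ring
    rw [airyProfile, this, ← mul_assoc, ← Complex.exp_add]
    simp
  obtain ⟨R, hR0, hR1⟩ := hM.exists
  have hM₀ : 0 ≤ M₀ := (norm_nonneg _).trans hR0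
  have hM₁ : 0 ≤ M₁ := (norm_nonneg _).trans hR1
  rw [← hX] at hM
  have h0 := abs_le_two_mul_of_tendsto (f := u) (x := x) (c := 1) hl0
    (fun k => by rw [hprof]; simp) (hM.mono fun R hR => hR.1)
  have h1 := abs_le_two_mul_of_tendsto (f := derivCLM ℝ ℝ u) (x := x)
    (c := 2 * π * Complex.I * l) hl0
    (fun k => by rw [FT_derivCLM, hprof]; simp only [id]; push_cast; ring)
    (hM.mono fun R hR => hR.2)
  have hc : ‖(2 * π * Complex.I * l : ℂ)‖ = 2 * π * l := by
    simp [abs_of_pos hπ, abs_of_pos hl0]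
  rw [hc, coe_derivCLM] at h1
  rw [norm_one, mul_one] at h0
  have hlr' : 2 * (l * r) ≤ 1 := by
    have : 0 < l * r := by positivity
    nlinarith
  constructor
  · calc r * |u x| ≤ r * (2 * l * M₀) := by gcongr
      _ = 2 * (l * r) * M₀ := by ring
      _ ≤ 1 * M₀ := by gcongr
      _ = M₀ := one_mul _
  · calc r ^ 2 * |deriv ⇑u x| ≤ r ^ 2 * (2 * l * (2 * π * l) * M₁) := by gcongr
      _ = 2 * (l * r) * (2 * π * l * r) * M₁ := by ring
      _ ≤ 1 * M₁ := by rw [hlr, mul_one]; gcongr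
      _ = M₁ := one_mul _

end SchwartzMap

/-- The Japanese bracket in self-similar variables. -/
lemma jb_pow_three {r : ℝ} (hr : 0 < r) (x : ℝ) : jb (r ^ 3) x = r * √((x / r) ^ 2 + 1) := by
  have h : (r ^ 3) ^ ((2:ℝ) / 3) = r ^ 2 := by
    rw [← rpow_natCast, ← rpow_mul hr.le, ← rpow_natCast]
    norm_num
  rw [jb, h, ← sqrt_eq_rpow, show x ^ 2 + r ^ 2 = r ^ 2 * ((x / r) ^ 2 + 1) by field_simp,
    sqrt_mul (sq_nonneg r), sqrt_sq hr.le]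

/-- Fixed-time pointwise bounds from `Ḃ^{-1/2}_{2,∞}` control of `u`
and `Ḣ^{1/2}` control of `L(t)u = xu - 3tu''`. -/
theorem fixed_time_klainerman_sobolev :
    ∃ C : ℝ, 0 < C ∧ ∀ t : ℝ, 0 < t → ∀ u : 𝓢(ℝ, ℝ),
      BesovNorm ⇑u
        + HsNorm ((1:ℝ)/2) (fun x => x * u x - 3 * t * iteratedDeriv 2 (⇑u) x) ≤ 1 →
      (∀ x : ℝ,
        t ^ ((1:ℝ)/4) * jb t x ^ ((1:ℝ)/4) * |u x|
          + t ^ ((3:ℝ)/4) * jb t x ^ (-(1:ℝ)/4) * |deriv (⇑u) x| ≤ C) ∧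
      (∀ x : ℝ, 2 * t ^ ((1:ℝ)/3) ≤ x →
        jb t x * |u x| + t ^ ((1:ℝ)/2) * jb t x ^ ((1:ℝ)/2) * |deriv (⇑u) x|
          ≤ C * Real.log (t ^ (-(1:ℝ)/3) * jb t x)) := by
  refine ⟨4000, by norm_num, fun t ht u hu => ?_⟩
  obtain ⟨r, hr, rfl⟩ : ∃ r : ℝ, 0 < r ∧ t = r ^ 3 :=
    ⟨t ^ ((1:ℝ) / 3), rpow_pos_of_pos ht _, by
      rw [← rpow_natCast, ← rpow_mul ht.le]; norm_num⟩
  rw [← SchwartzMap.coe_airyOp] at hu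
  have hB := SchwartzMap.BesovNorm_nonneg ⇑u
  have hH := SchwartzMap.HsNorm_nonneg (1/2) ⇑(SchwartzMap.airyOp (r ^ 3) u)
  have hg := (SchwartzMap.criticalAmplitude_airyProfile (by linarith) (by linarith)
    : CriticalAmplitude 8 (SchwartzMap.airyProfile (r ^ 3) u) _).comp_mul_left
    (inv_pos.2 (mul_pos two_pi_pos hr))
  have hrpow : ∀ a : ℝ, (r ^ 3) ^ a = r ^ (3 * a) := fun a => by
    rw [← rpow_natCast, ← rpow_mul hr.le]; norm_num
  have hS : ∀ x : ℝ, 0 < √((x / r) ^ 2 + 1) := fun x => sqrt_pos.2 (by positivity)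
  have hjb : ∀ x a : ℝ, jb (r ^ 3) x ^ a = r ^ a * √((x / r) ^ 2 + 1) ^ a := fun x a => by
    rw [jb_pow_three hr, mul_rpow hr.le (hS x).le]
  have key : ∀ x a b : ℝ, (r ^ 3) ^ a * jb (r ^ 3) x ^ b =
      r ^ (3 * a + b) * √((x / r) ^ 2 + 1) ^ b := fun x a b => by
    rw [hjb, hrpow, ← mul_assoc, ← rpow_add hr]
  refine ⟨fun x => ?_, fun x hx => ?_⟩
  · obtain ⟨h0, h1⟩ := SchwartzMap.abs_apply_and_abs_deriv_le hr u x
      (hg.eventually_norm_cubicIntegral_le (x / r))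
    rw [key, key]
    have hS := hS x
    set S := √((x / r) ^ 2 + 1)
    norm_num at h0 h1 ⊢
    have e : S ^ (1 / 4 : ℝ) * S ^ (-(1 / 4) : ℝ) = 1 := by
      rw [← rpow_add hS]; norm_num
    have h0' := mul_le_mul_of_nonneg_left h0 (rpow_nonneg hS.le (1/4))
    have h1' := mul_le_mul_of_nonneg_left h1 (rpow_nonneg hS.le (-(1/4)))
    linarith
  · rw [hrpow] at hx
    have hX : 2 ≤ x / r := by
      rw [le_div_iff₀ hr]; norm_num at hx; exact hx
    obtain ⟨h0, h1⟩ := SchwartzMap.abs_apply_and_abs_deriv_le hr u x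
      (hg.eventually_norm_cubicIntegral_le_log hX)
    rw [key, jb_pow_three hr, hrpow]
    have hS := hS x
    have hlog : 0 ≤ log √((x / r) ^ 2 + 1) :=
      log_nonneg (one_le_sqrt.2 (by nlinarith [sq_nonneg (x / r)]))
    set S := √((x / r) ^ 2 + 1)
    norm_num [rpow_neg_one] at h0 h1 ⊢
    rw [inv_mul_cancel_left₀ hr.ne']
    have e : S ^ (1 / 2 : ℝ) * S ^ (-(1 / 2) : ℝ) = 1 := by
      rw [← rpow_add hS]; norm_num
    have e' : S * S⁻¹ = 1 := mul_inv_cancel₀ hS.ne'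
    have h0' := mul_le_mul_of_nonneg_left h0 hS.le
    have h1' := mul_le_mul_of_nonneg_left h1 (rpow_nonneg hS.le (1/2))
    have f0 : S * (1164 * (log S * S⁻¹)) = 1164 * log S * (S * S⁻¹) := by ring
    have f1 : S ^ (1 / 2 : ℝ) * (1164 * (log S * S ^ (-(1 / 2) : ℝ))) =
        1164 * log S * (S ^ (1 / 2 : ℝ) * S ^ (-(1 / 2) : ℝ)) := by ring
    rw [f0, e'] at h0'
    rw [f1, e] at h1'
    linarith
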